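/- Let N ≥ 1, 0 < γ < min{2,N}, 1 < p < p_F := 1 + 2/N, z ∈ ℝ^N \ {0} and 0 < T < ∞ with T ≤ |z|². There exist constants c* > 0 and C* > 0 depending only on N, p, γ (and not on T or z) with the following property: if u₀ is the nonnegative Radon measure u₀ = c |z|^{γ/(p−1)} δ_z + φ dx, where δ_z is the Dirac measure concentrated at z and φ ∈ L^∞(ℝ^N) is nonnegative with ‖φ‖_{L^∞} ≤ C₀, and if 0 < c ≤ c* T^{−N(p_F−p)/(2(p−1))} and 0 ≤ C₀ ≤ C* T^{−(2−γ)/(2(p−1))}, then the Hardy parabolic equation ∂_t u − Δu = |x|^{−γ} u^p with initial data u₀ possesses a solution on ℝ^N × [0,T). -/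

import Mathlib

open MeasureTheory Real Set

noncomputable def heatKernel (N : ℕ) (x : EuclideanSpace ℝ (Fin N)) (t : ℝ) : ℝ :=
  (4 * Real.pi * t) ^ (-(N : ℝ) / 2) * Real.exp (-‖x‖ ^ 2 / (4 * t))

/-- `u` is a (nonnegative, integral) solution of `∂_t u - Δu = |x|^{-γ} u^p`
with initial data the nonnegative Radon measure `μ`, on `ℝ^N × [0,T)`. -/
def IsSolMeas (N : ℕ) (γ p T : ℝ) (μ : Measure (EuclideanSpace ℝ (Fin N)))
    (u : EuclideanSpace ℝ (Fin N) → ℝ → ℝ) : Prop :=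
  Measurable (Function.uncurry u) ∧ (∀ x t, 0 ≤ u x t) ∧
    ∀ᵐ q : EuclideanSpace ℝ (Fin N) × ℝ,
      q.2 ∈ Set.Ioo 0 T →
        u q.1 q.2 = (∫ y, heatKernel N (q.1 - y) q.2 ∂μ) +
          ∫ s in Set.Ioo 0 q.2, ∫ y,
            heatKernel N (q.1 - y) (q.2 - s) * ‖y‖ ^ (-γ) * u y s ^ p

open scoped ENNReal

section Picard

variable {N : ℕ}

theorem heatKernel_nonneg (x : EuclideanSpace ℝ (Fin N)) {t : ℝ} (ht : 0 ≤ t) :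
    0 ≤ heatKernel N x t := by
  unfold heatKernel
  positivity

@[fun_prop]
theorem Measurable.heatKernel {α : Type*} [MeasurableSpace α] {f : α → EuclideanSpace ℝ (Fin N)}
    {g : α → ℝ} (hf : Measurable f) (hg : Measurable g) :
    Measurable fun a => heatKernel N (f a) (g a) := by
  unfold _root_.heatKernel
  fun_prop

/-- The right-hand side of the integral equation, with values in `[0, ∞]`. -/
noncomputable def picardMap (γ p : ℝ) (μ : Measure (EuclideanSpace ℝ (Fin N)))
    (U : EuclideanSpace ℝ (Fin N) → ℝ → ℝ≥0∞) (x : EuclideanSpace ℝ (Fin N)) (t : ℝ) : ℝ≥0∞ :=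
  (∫⁻ y, ENNReal.ofReal (heatKernel N (x - y) t) ∂μ) +
    ∫⁻ s in Ioo 0 t, ∫⁻ y,
      ENNReal.ofReal (heatKernel N (x - y) (t - s) * ‖y‖ ^ (-γ)) * U y s ^ p

variable {γ p : ℝ} {μ : Measure (EuclideanSpace ℝ (Fin N))}
  {U V : EuclideanSpace ℝ (Fin N) → ℝ → ℝ≥0∞}

theorem measurable_uncurry_picardMap [SFinite μ] (hU : Measurable (Function.uncurry U)) :
    Measurable (Function.uncurry (picardMap γ p μ U)) := by
  have hU' : Measurable fun r : ((EuclideanSpace ℝ (Fin N) × ℝ) × ℝ) × EuclideanSpace ℝ (Fin N) =>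
      U r.2 r.1.2 := hU.comp (measurable_snd.prodMk (measurable_snd.comp measurable_fst))
  have h1 : Measurable fun q : EuclideanSpace ℝ (Fin N) × ℝ =>
      ∫⁻ y, ENNReal.ofReal (heatKernel N (q.1 - y) q.2) ∂μ := by
    refine Measurable.lintegral_prod_right'
      (f := fun r : (EuclideanSpace ℝ (Fin N) × ℝ) × EuclideanSpace ℝ (Fin N) =>
        ENNReal.ofReal (heatKernel N (r.1.1 - r.2) r.1.2)) ?_
    fun_prop
  have h2 : Measurable fun r : (EuclideanSpace ℝ (Fin N) × ℝ) × ℝ =>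
      ∫⁻ y, ENNReal.ofReal (heatKernel N (r.1.1 - y) (r.1.2 - r.2) * ‖y‖ ^ (-γ)) * U y r.2 ^ p := by
    refine Measurable.lintegral_prod_right'
      (f := fun r : ((EuclideanSpace ℝ (Fin N) × ℝ) × ℝ) × EuclideanSpace ℝ (Fin N) =>
        ENNReal.ofReal (heatKernel N (r.1.1.1 - r.2) (r.1.1.2 - r.1.2) * ‖r.2‖ ^ (-γ)) *
          U r.2 r.1.2 ^ p) ?_
    fun_prop
  have h3 : MeasurableSet
      {r : (EuclideanSpace ℝ (Fin N) × ℝ) × ℝ | r.2 ∈ Ioo 0 r.1.2} :=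
    (measurableSet_lt measurable_const measurable_snd).inter
      (measurableSet_lt measurable_snd (measurable_snd.comp measurable_fst))
  refine h1.add ?_
  convert Measurable.lintegral_prod_right' (ν := (volume : Measure ℝ)) (h2.indicator h3) using 2
  rw [← lintegral_indicator measurableSet_Ioo]
  rfl

theorem picardMap_mono_of_le (hp : 0 ≤ p) {x : EuclideanSpace ℝ (Fin N)} {t : ℝ}
    (h : ∀ s ∈ Ioo 0 t, ∀ y, U y s ≤ V y s) :
    picardMap γ p μ U x t ≤ picardMap γ p μ V x t := by
  refine add_le_add le_rfl (setLIntegral_mono' measurableSet_Ioo fun s hs => ?_)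
  exact lintegral_mono fun y => mul_le_mul_right (ENNReal.rpow_le_rpow (h s hs y) hp) _

theorem picardMap_iSup (hp : 0 < p) {U : ℕ → EuclideanSpace ℝ (Fin N) → ℝ → ℝ≥0∞}
    (hU : ∀ n, Measurable (Function.uncurry (U n))) (hmono : Monotone U)
    (x : EuclideanSpace ℝ (Fin N)) (t : ℝ) :
    picardMap γ p μ (fun y s => ⨆ n, U n y s) x t = ⨆ n, picardMap γ p μ (U n) x t := by
  have hm : ∀ n, Measurable fun r : ℝ × EuclideanSpace ℝ (Fin N) =>
      ENNReal.ofReal (heatKernel N (x - r.2) (t - r.1) * ‖r.2‖ ^ (-γ)) * U n r.2 r.1 ^ p := by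
    intro n
    have : Measurable fun r : ℝ × EuclideanSpace ℝ (Fin N) => U n r.2 r.1 :=
      (hU n).comp measurable_swap
    fun_prop
  have hle : ∀ s y, Monotone fun n =>
      ENNReal.ofReal (heatKernel N (x - y) (t - s) * ‖y‖ ^ (-γ)) * U n y s ^ p :=
    fun s y m n hmn => mul_le_mul_right (ENNReal.rpow_le_rpow (hmono hmn y s) hp.le) _
  simp only [picardMap]
  rw [← ENNReal.add_iSup]
  congr 1
  rw [← lintegral_iSup (fun n => (hm n).lintegral_prod_right')
    (fun m n hmn s => lintegral_mono fun y => hle s y hmn)]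
  refine lintegral_congr fun s => ?_
  refine Eq.trans ?_ (lintegral_iSup (fun n => (hm n).comp measurable_prodMk_left)
    (fun m n hmn y => hle s y hmn))
  refine lintegral_congr fun y => ?_
  rw [← ENNReal.mul_iSup]
  congr 1
  exact (ENNReal.orderIsoRpow p hp).map_iSup _

/-- A finite supersolution of the integral equation yields a solution. -/
theorem exists_isSolMeas_of_supersolution [SFinite μ] {T : ℝ} (hp : 0 < p)
    {W : EuclideanSpace ℝ (Fin N) → ℝ → ℝ≥0∞}
    (hW : ∀ t ∈ Ioo 0 T, ∀ x, W x t < ∞)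
    (hsuper : ∀ t ∈ Ioo 0 T, ∀ x, picardMap γ p μ W x t ≤ W x t) :
    ∃ u, IsSolMeas N γ p T μ u := by
  set U : ℕ → EuclideanSpace ℝ (Fin N) → ℝ → ℝ≥0∞ := fun n => (picardMap γ p μ)^[n] 0 with hUdef
  have hsucc : ∀ n, U (n + 1) = picardMap γ p μ (U n) :=
    fun n => Function.iterate_succ_apply' _ _ _
  have hmeas : ∀ n, Measurable (Function.uncurry (U n)) := by
    intro n
    induction n with
    | zero => exact measurable_const
    | succ n ih => rw [hsucc]; exact measurable_uncurry_picardMap ih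
  have hmono : Monotone U := by
    refine monotone_nat_of_le_succ fun n => ?_
    induction n with
    | zero => exact fun x t => zero_le
    | succ n ih =>
      rw [hsucc, hsucc (n + 1)]
      exact fun x t => picardMap_mono_of_le hp.le fun s _ y => ih y s
  have hbound : ∀ n, ∀ t ∈ Ioo 0 T, ∀ x, U n x t ≤ W x t := by
    intro n
    induction n with
    | zero => exact fun t _ x => zero_le
    | succ n ih =>
      intro t ht x
      rw [hsucc]
      exact (picardMap_mono_of_le hp.le fun s hs y => ih s ⟨hs.1, hs.2.trans ht.2⟩ y).trans
        (hsuper t ht x)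
  set V : EuclideanSpace ℝ (Fin N) → ℝ → ℝ≥0∞ := fun x t => ⨆ n, U n x t with hVdef
  have hVmeas : Measurable (Function.uncurry V) := Measurable.iSup hmeas
  have hVfin : ∀ t ∈ Ioo 0 T, ∀ x, V x t ≠ ∞ := fun t ht x =>
    ((iSup_le fun n => hbound n t ht x).trans_lt (hW t ht x)).ne
  have hfix : ∀ x t, V x t = picardMap γ p μ V x t := by
    intro x t
    rw [hVdef, picardMap_iSup hp hmeas hmono]
    refine le_antisymm (iSup_le fun n => ?_) (iSup_le fun n => ?_)
    · exact (hmono n.le_succ x t).trans (hsucc n ▸ le_iSup (fun n => picardMap γ p μ (U n) x t) n)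
    · exact (hsucc n ▸ le_iSup (fun n => U n x t) (n + 1) :)
  refine ⟨fun x t => (V x t).toReal, hVmeas.ennreal_toReal, fun x t => ENNReal.toReal_nonneg,
    Filter.Eventually.of_forall ?_⟩
  rintro ⟨x, t⟩ ht
  have ht' : t ∈ Ioo 0 T := ht
  have hfin := hVfin t ht' x
  rw [hfix, picardMap] at hfin
  obtain ⟨hfin1, hfin2⟩ := ENNReal.add_ne_top.1 hfin
  have hm : Measurable fun r : ℝ × EuclideanSpace ℝ (Fin N) =>
      ENNReal.ofReal (heatKernel N (x - r.2) (t - r.1) * ‖r.2‖ ^ (-γ)) * V r.2 r.1 ^ p := by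
    have : Measurable fun r : ℝ × EuclideanSpace ℝ (Fin N) => V r.2 r.1 :=
      hVmeas.comp measurable_swap
    fun_prop
  have hmI := hm.lintegral_prod_right' (ν := volume)
  simp only
  rw [hfix, picardMap, ENNReal.toReal_add hfin1 hfin2]
  congr 1
  · rw [integral_eq_lintegral_of_nonneg_ae
      (Filter.Eventually.of_forall fun y => heatKernel_nonneg _ ht'.1.le)]
    exact (by fun_prop : Measurable fun y => heatKernel N (x - y) t).aestronglyMeasurable
  · rw [← integral_toReal hmI.aemeasurable (ae_lt_top hmI hfin2)]
    refine setIntegral_congr_fun measurableSet_Ioo fun s hs => ?_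
    have hs' : s ∈ Ioo 0 T := ⟨hs.1, hs.2.trans ht'.2⟩
    have hV : Measurable fun y => V y s := hVmeas.comp measurable_prodMk_right
    have hnn : ∀ y, 0 ≤ heatKernel N (x - y) (t - s) * ‖y‖ ^ (-γ) := fun y =>
      mul_nonneg (heatKernel_nonneg _ (sub_nonneg.2 hs.2.le)) (by positivity)
    simp only
    rw [integral_eq_lintegral_of_nonneg_ae]
    · congr 1
      refine lintegral_congr fun y => ?_
      rw [ENNReal.ofReal_mul (hnn y), ENNReal.toReal_rpow,
        ENNReal.ofReal_toReal (ENNReal.rpow_ne_top_of_nonneg hp.le (hVfin s hs' y))]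
    · exact Filter.Eventually.of_forall fun y => mul_nonneg (hnn y) (by positivity)
    · exact (by fun_prop : Measurable _).aestronglyMeasurable

end Picard

section KernelEstimates

variable {N : ℕ}

theorem lintegral_exp_neg_norm_sub_sq (m : EuclideanSpace ℝ (Fin N)) {t : ℝ} (ht : 0 < t) :
    ∫⁻ y, ENNReal.ofReal (rexp (-‖y - m‖ ^ 2 / (4 * t))) =
      ENNReal.ofReal ((4 * π * t) ^ ((N : ℝ) / 2)) := by
  have hval := GaussianFourier.integral_rexp_neg_mul_sq_norm (V := EuclideanSpace ℝ (Fin N))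
    (b := 1 / (4 * t)) (by positivity)
  have hpi : π / (1 / (4 * t)) = 4 * π * t := by field_simp
  rw [finrank_euclideanSpace_fin, hpi] at hval
  have hne : (4 * π * t) ^ ((N : ℝ) / 2) ≠ 0 := by positivity
  have hint : Integrable fun y : EuclideanSpace ℝ (Fin N) => rexp (-(1 / (4 * t)) * ‖y‖ ^ 2) :=
    Integrable.of_integral_ne_zero (hval ▸ hne)
  rw [lintegral_sub_right_eq_self
    (fun y : EuclideanSpace ℝ (Fin N) => ENNReal.ofReal (rexp (-‖y‖ ^ 2 / (4 * t)))) m, ← hval,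
    ofReal_integral_eq_lintegral_ofReal hint (Filter.Eventually.of_forall fun y => by positivity)]
  refine lintegral_congr fun y => ?_
  congr 2
  ring

theorem lintegral_heatKernel (x : EuclideanSpace ℝ (Fin N)) {t : ℝ} (ht : 0 < t) :
    ∫⁻ y, ENNReal.ofReal (heatKernel N (x - y) t) = 1 := by
  have h4 : (0 : ℝ) < 4 * π * t := by positivity
  simp_rw [heatKernel, ENNReal.ofReal_mul (show 0 ≤ (4 * π * t) ^ (-(N : ℝ) / 2) by positivity),
    norm_sub_rev x]
  rw [lintegral_const_mul _ (by fun_prop), lintegral_exp_neg_norm_sub_sq x ht,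
    ← ENNReal.ofReal_mul (by positivity), ← rpow_add h4]
  simp [neg_div]

/-- The semigroup property of the heat kernel. -/
theorem lintegral_heatKernel_mul_heatKernel (x z : EuclideanSpace ℝ (Fin N)) {a b : ℝ}
    (ha : 0 < a) (hb : 0 < b) :
    ∫⁻ y, ENNReal.ofReal (heatKernel N (x - y) a * heatKernel N (y - z) b) =
      ENNReal.ofReal (heatKernel N (x - z) (a + b)) := by
  set m : EuclideanSpace ℝ (Fin N) := (b / (a + b)) • x + (a / (a + b)) • z with hm
  set τ : ℝ := a * b / (a + b) with hτ
  have hτ0 : 0 < τ := by positivity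
  have hsq : ∀ y : EuclideanSpace ℝ (Fin N),
      -‖x - y‖ ^ 2 / (4 * a) + -‖y - z‖ ^ 2 / (4 * b) =
        -‖x - z‖ ^ 2 / (4 * (a + b)) + -‖y - m‖ ^ 2 / (4 * τ) := by
    intro y
    have hym : y - m = (b / (a + b)) • (y - x) + (a / (a + b)) • (y - z) := by
      rw [hm]
      match_scalars <;> field_simp
      ring
    have hxz : x - z = (y - z) - (y - x) := by abel
    rw [hym, hxz, norm_sub_rev x y]
    generalize y - x = v
    generalize y - z = w
    rw [norm_sub_sq_real, norm_add_sq_real, norm_smul, norm_smul,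
      real_inner_smul_left, real_inner_smul_right, real_inner_comm w v,
      Real.norm_of_nonneg (by positivity), Real.norm_of_nonneg (by positivity), hτ]
    field_simp
    ring
  have hc : (4 * π * a) ^ (-(N : ℝ) / 2) * (4 * π * b) ^ (-(N : ℝ) / 2) =
      (4 * π * (a + b)) ^ (-(N : ℝ) / 2) * (4 * π * τ) ^ (-(N : ℝ) / 2) := by
    rw [← mul_rpow (by positivity) (by positivity), ← mul_rpow (by positivity) (by positivity), hτ]
    congr 1
    field_simp
  have hprod : ∀ y, heatKernel N (x - y) a * heatKernel N (y - z) b =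
      heatKernel N (x - z) (a + b) *
        ((4 * π * τ) ^ (-(N : ℝ) / 2) * rexp (-‖y - m‖ ^ 2 / (4 * τ))) := by
    intro y
    unfold heatKernel
    rw [mul_mul_mul_comm, ← Real.exp_add, hsq, hc, Real.exp_add]
    ring
  simp_rw [hprod, ENNReal.ofReal_mul (heatKernel_nonneg (x - z) (add_pos ha hb).le)]
  rw [lintegral_const_mul _ (by fun_prop)]
  have h1 := lintegral_heatKernel m hτ0
  simp_rw [heatKernel, norm_sub_rev m] at h1
  rw [h1, mul_one]

theorem heatKernel_le (x : EuclideanSpace ℝ (Fin N)) {t : ℝ} (ht : 0 < t) :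
    heatKernel N x t ≤ (4 * π * t) ^ (-(N : ℝ) / 2) := by
  refine mul_le_of_le_one_right (by positivity) (Real.exp_le_one_iff.2 ?_)
  rw [neg_div]
  exact neg_nonpos.2 (by positivity)

theorem heatKernel_rpow_le (x : EuclideanSpace ℝ (Fin N)) {t p : ℝ} (ht : 0 < t) (hp : 1 < p) :
    heatKernel N x t ^ p ≤ (4 * π * t) ^ (-(N * (p - 1) / 2)) * heatKernel N x t := by
  have h0 := heatKernel_nonneg x ht.le
  calc heatKernel N x t ^ p = heatKernel N x t ^ (p - 1) * heatKernel N x t := by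
        rw [← rpow_add_one' h0 (by linarith), sub_add_cancel]
    _ ≤ ((4 * π * t) ^ (-(N : ℝ) / 2)) ^ (p - 1) * heatKernel N x t := by
        gcongr
        exact heatKernel_le x ht
    _ = _ := by
        rw [← rpow_mul (by positivity)]
        congr 2
        ring

theorem exp_neg_le_rpow {m x : ℝ} (hm : 0 < m) (hx : 0 < x) : rexp (-x) ≤ m ^ m * x ^ (-m) := by
  have h1 : x / m ≤ rexp (x / m) := by linarith [Real.add_one_le_exp (x / m)]
  have h2 := rpow_le_rpow (by positivity) h1 hm.le
  rw [← Real.exp_mul, div_mul_cancel₀ _ hm.ne', div_rpow hx.le hm.le,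
    div_le_iff₀ (by positivity)] at h2
  rw [Real.exp_neg, rpow_neg hx.le, ← div_eq_mul_inv, inv_le_comm₀ (by positivity) (by positivity),
    inv_div, div_le_iff₀ (by positivity)]
  exact h2

/-- Off-diagonal decay of the heat kernel. -/
theorem heatKernel_sub_le_of_norm_lt {y z : EuclideanSpace ℝ (Fin N)} {t k : ℝ} (ht : 0 < t)
    (hk : 0 < N + k) (hy : ‖y‖ < ‖z‖ / 2) :
    heatKernel N (y - z) t ≤
      (((N + k) / 2) ^ ((N + k) / 2) * 16 ^ ((N + k) / 2) * (4 * π) ^ (-(N : ℝ) / 2)) *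
        t ^ (k / 2) * ‖z‖ ^ (-(N + k)) := by
  have hz : 0 < ‖z‖ := by linarith [norm_nonneg y]
  have hd : ‖z‖ / 2 ≤ ‖y - z‖ := by
    have := norm_sub_norm_le z y
    rw [norm_sub_rev] at this
    linarith
  have hexp : rexp (-‖y - z‖ ^ 2 / (4 * t)) ≤ rexp (-(‖z‖ ^ 2 / (16 * t))) := by
    refine Real.exp_le_exp.2 ?_
    rw [neg_div, neg_le_neg_iff]
    calc ‖z‖ ^ 2 / (16 * t) = (‖z‖ / 2) ^ 2 / (4 * t) := by field_simp; norm_num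
      _ ≤ _ := by gcongr
  set m := (N + k) / 2 with hm
  have hm0 : 0 < m := by positivity
  have hpow : (‖z‖ ^ 2 / (16 * t)) ^ (-m) = 16 ^ m * t ^ m * ‖z‖ ^ (-(N + k)) := by
    rw [div_rpow (by positivity) (by positivity), mul_rpow (by positivity) ht.le,
      rpow_neg ht.le, rpow_neg (by norm_num : (0 : ℝ) ≤ 16), ← rpow_natCast ‖z‖ 2,
      ← rpow_mul hz.le]
    have : ((2 : ℕ) : ℝ) * -m = -(N + k) := by rw [hm]; push_cast; ring
    rw [this]
    field_simp
  have ht' : t ^ (-(N : ℝ) / 2) * t ^ m = t ^ (k / 2) := by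
    rw [← rpow_add ht, hm]
    congr 1
    ring
  calc heatKernel N (y - z) t
      ≤ (4 * π * t) ^ (-(N : ℝ) / 2) * (m ^ m * (‖z‖ ^ 2 / (16 * t)) ^ (-m)) := by
        unfold heatKernel
        gcongr
        exact hexp.trans (exp_neg_le_rpow hm0 (by positivity))
    _ = _ := by
        rw [hpow, mul_rpow (by positivity) ht.le, ← ht']
        ring

theorem lintegral_Ioo_rpow {θ t : ℝ} (hθ : θ < 1) (ht : 0 < t) :
    ∫⁻ s in Ioo 0 t, ENNReal.ofReal (s ^ (-θ)) = ENNReal.ofReal (t ^ (1 - θ) / (1 - θ)) := by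
  have hint := intervalIntegral.intervalIntegrable_rpow' (a := 0) (b := t) (r := -θ) (by linarith)
  rw [intervalIntegrable_iff_integrableOn_Ioo_of_le ht.le] at hint
  rw [← ofReal_integral_eq_lintegral_ofReal hint
    ((ae_restrict_mem measurableSet_Ioo).mono fun s hs => by have := hs.1.le; positivity),
    ← integral_Ioc_eq_integral_Ioo, ← intervalIntegral.integral_of_le ht.le,
    integral_rpow (Or.inl (by linarith)), zero_rpow (by linarith), sub_zero,
    show -θ + 1 = 1 - θ by ring]

theorem lintegral_Ioo_sub_rpow {θ t : ℝ} (hθ : θ < 1) (ht : 0 < t) :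
    ∫⁻ s in Ioo 0 t, ENNReal.ofReal ((t - s) ^ (-θ)) =
      ENNReal.ofReal (t ^ (1 - θ) / (1 - θ)) := by
  rw [← lintegral_Ioo_rpow hθ ht, ← lintegral_indicator measurableSet_Ioo,
    ← lintegral_indicator measurableSet_Ioo,
    ← lintegral_sub_left_eq_self ((Ioo 0 t).indicator fun s => ENNReal.ofReal (s ^ (-θ))) t]
  refine lintegral_congr fun s => ?_
  by_cases hs : s ∈ Ioo 0 t
  · rw [indicator_of_mem hs, indicator_of_mem (show t - s ∈ Ioo 0 t from
      ⟨by linarith [hs.2], by linarith [hs.1]⟩)]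
  · rw [indicator_of_notMem hs, indicator_of_notMem]
    exact fun h => hs ⟨by linarith [h.2], by linarith [h.1]⟩

theorem exists_setLIntegral_ball_norm_rpow_le (hN : 1 ≤ N) {γ : ℝ} (hγ : γ < N) :
    ∃ K : ℝ, 0 < K ∧ ∀ r : ℝ, 0 < r →
      ∫⁻ y : EuclideanSpace ℝ (Fin N) in Metric.ball 0 r, ENNReal.ofReal (‖y‖ ^ (-γ)) ≤
        ENNReal.ofReal (K * r ^ (N - γ)) := by
  have : Nontrivial (EuclideanSpace ℝ (Fin N)) :=
    Module.nontrivial_of_finrank_pos (R := ℝ) (by rw [finrank_euclideanSpace_fin]; omega)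
  set B : ℝ := (volume : Measure (EuclideanSpace ℝ (Fin N))).real (Metric.ball 0 1) with hB
  have hB0 : 0 ≤ B := measureReal_nonneg
  have hNγ : 0 < N - γ := by linarith
  refine ⟨N * B / (N - γ) + 1, by positivity, fun r hr => ?_⟩
  have hpow : ∀ s ∈ Ioo 0 r, s ^ (N - 1) • s ^ (-γ) = s ^ ((N : ℝ) - 1 - γ) := by
    intro s hs
    rw [smul_eq_mul, ← rpow_natCast, ← rpow_add hs.1, Nat.cast_sub hN]
    congr 1
    push_cast
    ring
  have hint1 : IntegrableOn (fun s : ℝ => s ^ (N - 1) • s ^ (-γ)) (Ioo 0 r) := by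
    rw [integrableOn_congr_fun hpow measurableSet_Ioo,
      ← intervalIntegrable_iff_integrableOn_Ioo_of_le hr.le]
    exact intervalIntegral.intervalIntegrable_rpow' (by linarith)
  have hint : IntegrableOn (fun y : EuclideanSpace ℝ (Fin N) => ‖y‖ ^ (-γ)) (Metric.ball 0 r) := by
    rw [integrableOn_fun_norm_addHaar volume (f := fun s : ℝ => s ^ (-γ)),
      finrank_euclideanSpace_fin]
    exact hint1
  rw [← ofReal_integral_eq_lintegral_ofReal hint
    (Filter.Eventually.of_forall fun y => by positivity)]
  refine ENNReal.ofReal_le_ofReal ?_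
  have hind : ∀ y : EuclideanSpace ℝ (Fin N),
      (Metric.ball (0 : EuclideanSpace ℝ (Fin N)) r).indicator (fun y => ‖y‖ ^ (-γ)) y =
        (Iio r).indicator (fun s : ℝ => s ^ (-γ)) ‖y‖ := by
    intro y
    simp [indicator]
  have hind' : ∀ s : ℝ, (Ioi (0 : ℝ)).indicator
      (fun s => s ^ (N - 1) • (Iio r).indicator (fun s : ℝ => s ^ (-γ)) s) s =
        (Ioo 0 r).indicator (fun s => s ^ (N - 1) • s ^ (-γ)) s := by
    intro s
    by_cases h1 : 0 < s <;> by_cases h2 : s < r <;> simp [indicator, h1, h2]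
  rw [← integral_indicator measurableSet_ball, integral_congr_ae (ae_of_all _ hind),
    integral_fun_norm_addHaar volume, finrank_euclideanSpace_fin,
    ← integral_indicator measurableSet_Ioi, integral_congr_ae (ae_of_all _ hind'),
    integral_indicator measurableSet_Ioo, setIntegral_congr_fun measurableSet_Ioo hpow,
    ← integral_Ioc_eq_integral_Ioo, ← intervalIntegral.integral_of_le hr.le,
    integral_rpow (Or.inl (by linarith)), zero_rpow (by linarith), sub_zero, ← hB,
    show (N : ℝ) - 1 - γ + 1 = N - γ by ring, nsmul_eq_mul, smul_eq_mul, add_mul, one_mul]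
  have : 0 ≤ r ^ (N - γ) := by positivity
  have h : (N : ℝ) * (B * (r ^ (N - γ) / (N - γ))) = N * B / (N - γ) * r ^ (N - γ) := by ring
  linarith

/-- The heat semigroup applied to `|x|^{-γ}` is bounded by a multiple of `t^{-γ/2}`. -/
theorem exists_lintegral_heatKernel_mul_norm_rpow_le (hN : 1 ≤ N) {γ : ℝ} (hγ0 : 0 < γ)
    (hγ : γ < N) :
    ∃ K : ℝ, 0 < K ∧ ∀ (x : EuclideanSpace ℝ (Fin N)) (t : ℝ), 0 < t →
      ∫⁻ y, ENNReal.ofReal (heatKernel N (x - y) t * ‖y‖ ^ (-γ)) ≤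
        ENNReal.ofReal (K * t ^ (-(γ / 2))) := by
  obtain ⟨K, hK, hball⟩ := exists_setLIntegral_ball_norm_rpow_le hN hγ
  refine ⟨(4 * π) ^ (-(N : ℝ) / 2) * K + 1, by positivity, fun x t ht => ?_⟩
  have hr : 0 < √t := Real.sqrt_pos.2 ht
  have hrpow : ∀ a : ℝ, √t ^ a = t ^ (a / 2) := by
    intro a
    rw [Real.sqrt_eq_rpow, ← rpow_mul ht.le]
    congr 1
    ring
  have hin : ∫⁻ y in Metric.ball 0 √t, ENNReal.ofReal (heatKernel N (x - y) t * ‖y‖ ^ (-γ)) ≤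
      ENNReal.ofReal ((4 * π) ^ (-(N : ℝ) / 2) * K * t ^ (-(γ / 2))) := by
    calc _ ≤ ∫⁻ y : EuclideanSpace ℝ (Fin N) in Metric.ball 0 √t,
          ENNReal.ofReal ((4 * π * t) ^ (-(N : ℝ) / 2)) * ENNReal.ofReal (‖y‖ ^ (-γ)) := by
          refine lintegral_mono fun y => ?_
          rw [← ENNReal.ofReal_mul (by positivity)]
          refine ENNReal.ofReal_le_ofReal ?_
          gcongr
          exact heatKernel_le _ ht
      _ ≤ ENNReal.ofReal ((4 * π * t) ^ (-(N : ℝ) / 2)) *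
            ENNReal.ofReal (K * √t ^ (N - γ)) := by
          rw [lintegral_const_mul _ (by fun_prop)]
          gcongr
          exact hball _ hr
      _ = _ := by
          rw [← ENNReal.ofReal_mul (by positivity), hrpow, mul_rpow (by positivity) ht.le]
          congr 1
          have : t ^ (-(γ / 2)) = t ^ (-(N : ℝ) / 2) * t ^ ((N - γ) / 2) := by
            rw [← rpow_add ht]
            congr 1
            ring
          rw [this]
          ring
  have hout : ∫⁻ y in (Metric.ball 0 √t)ᶜ,
      ENNReal.ofReal (heatKernel N (x - y) t * ‖y‖ ^ (-γ)) ≤ ENNReal.ofReal (t ^ (-(γ / 2))) := by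
    calc _ ≤ ∫⁻ y in (Metric.ball 0 √t)ᶜ,
          ENNReal.ofReal (t ^ (-(γ / 2))) * ENNReal.ofReal (heatKernel N (x - y) t) := by
          refine setLIntegral_mono' measurableSet_ball.compl fun y hy => ?_
          rw [← ENNReal.ofReal_mul (by positivity), mul_comm (t ^ _)]
          refine ENNReal.ofReal_le_ofReal (mul_le_mul_of_nonneg_left ?_ (heatKernel_nonneg _ ht.le))
          have hy' : √t ≤ ‖y‖ := by simpa using hy
          calc ‖y‖ ^ (-γ) ≤ √t ^ (-γ) := rpow_le_rpow_of_nonpos hr hy' (by linarith)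
            _ = _ := by rw [hrpow, neg_div]
      _ ≤ ∫⁻ y, ENNReal.ofReal (t ^ (-(γ / 2))) * ENNReal.ofReal (heatKernel N (x - y) t) :=
          setLIntegral_le_lintegral _ _
      _ = _ := by
          rw [lintegral_const_mul _ (by fun_prop), lintegral_heatKernel x ht, mul_one]
  rw [← lintegral_add_compl _ (measurableSet_ball (x := (0 : EuclideanSpace ℝ (Fin N))) (ε := √t)),
    add_mul, one_mul, ENNReal.ofReal_add (by positivity) (by positivity)]
  exact add_le_add hin hout

end KernelEstimates

section Supersolution

variable {N : ℕ}

/-- A bound for the singular source term when `a` can exceed `d` only away from the origin. -/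
theorem norm_rpow_mul_add_rpow_le {y z : EuclideanSpace ℝ (Fin N)} {γ p a d : ℝ} (hγ : 0 ≤ γ)
    (hp : 0 ≤ p) (hz : z ≠ 0) (ha : 0 ≤ a) (hd : 0 ≤ d) (hfar : ‖y‖ < ‖z‖ / 2 → a ≤ d) :
    ‖y‖ ^ (-γ) * (2 * a + 2 * d) ^ p ≤
      (4 * d) ^ p * ‖y‖ ^ (-γ) + 2 ^ γ * ‖z‖ ^ (-γ) * (4 * a) ^ p := by
  have hz' : 0 < ‖z‖ := norm_pos_iff.2 hz
  rcases le_or_gt a d with h | h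
  · calc _ ≤ ‖y‖ ^ (-γ) * (4 * d) ^ p := by
          gcongr
          linarith
      _ = (4 * d) ^ p * ‖y‖ ^ (-γ) := mul_comm _ _
      _ ≤ _ := le_add_of_nonneg_right (by positivity)
  · have hy : ‖z‖ / 2 ≤ ‖y‖ := not_lt.1 fun hlt => h.not_ge (hfar hlt)
    calc _ ≤ (‖z‖ / 2) ^ (-γ) * (4 * a) ^ p := by
          gcongr ?_ * ?_ ^ p
          · exact rpow_le_rpow_of_nonpos (by positivity) hy (by linarith)
          · linarith
      _ = 2 ^ γ * ‖z‖ ^ (-γ) * (4 * a) ^ p := by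
          rw [div_rpow hz'.le (by norm_num), rpow_neg (by norm_num : (0 : ℝ) ≤ 2), div_inv_eq_mul,
            mul_comm (2 ^ γ)]
      _ ≤ _ := le_add_of_nonneg_left (by positivity)

variable {γ p T A D K : ℝ} {z : EuclideanSpace ℝ (Fin N)}

theorem lintegral_heatKernel_mul_source_le (hγ : 0 < γ) (hp : 1 < p) (hz : z ≠ 0) (hA : 0 ≤ A)
    (hD : 0 ≤ D) (hK : 0 ≤ K) {s t : ℝ} (hs : s ∈ Ioo 0 t) (x : EuclideanSpace ℝ (Fin N))
    (hpot : ∀ (x : EuclideanSpace ℝ (Fin N)) (t : ℝ), 0 < t →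
      ∫⁻ y, ENNReal.ofReal (heatKernel N (x - y) t * ‖y‖ ^ (-γ)) ≤
        ENNReal.ofReal (K * t ^ (-(γ / 2))))
    (hfar : ∀ y : EuclideanSpace ℝ (Fin N), ‖y‖ < ‖z‖ / 2 → A * heatKernel N (y - z) s ≤ D) :
    ∫⁻ y, ENNReal.ofReal (heatKernel N (x - y) (t - s) * ‖y‖ ^ (-γ)) *
        ENNReal.ofReal (2 * (A * heatKernel N (y - z) s) + 2 * D) ^ p ≤
      ENNReal.ofReal ((4 * D) ^ p * K) * ENNReal.ofReal ((t - s) ^ (-(γ / 2))) +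
        ENNReal.ofReal (2 ^ γ * ‖z‖ ^ (-γ) * (4 * A) ^ p * (4 * π) ^ (-(N * (p - 1) / 2)) *
          heatKernel N (x - z) t) * ENNReal.ofReal (s ^ (-(N * (p - 1) / 2))) := by
  have hp0 : 0 < p := by linarith
  have hs0 : 0 < s := hs.1
  have hts : 0 < t - s := sub_pos.2 hs.2
  set L : ℝ := 2 ^ γ * ‖z‖ ^ (-γ) * (4 * A) ^ p * (4 * π) ^ (-(N * (p - 1) / 2)) *
    s ^ (-(N * (p - 1) / 2)) with hL
  have hL0 : 0 ≤ L := by positivity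
  have hpt : ∀ y, ENNReal.ofReal (heatKernel N (x - y) (t - s) * ‖y‖ ^ (-γ)) *
      ENNReal.ofReal (2 * (A * heatKernel N (y - z) s) + 2 * D) ^ p ≤
        ENNReal.ofReal ((4 * D) ^ p) *
          ENNReal.ofReal (heatKernel N (x - y) (t - s) * ‖y‖ ^ (-γ)) +
        ENNReal.ofReal L *
          ENNReal.ofReal (heatKernel N (x - y) (t - s) * heatKernel N (y - z) s) := by
    intro y
    have hG1 := heatKernel_nonneg (x - y) hts.le
    have hG2 := heatKernel_nonneg (y - z) hs0.le
    rw [ENNReal.ofReal_rpow_of_nonneg (by positivity) hp0.le, ← ENNReal.ofReal_mul (by positivity),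
      ← ENNReal.ofReal_mul (by positivity), ← ENNReal.ofReal_mul (by positivity),
      ← ENNReal.ofReal_add (by positivity) (by positivity)]
    refine ENNReal.ofReal_le_ofReal ?_
    have h1 := norm_rpow_mul_add_rpow_le hγ.le hp0.le hz (mul_nonneg hA hG2) hD (hfar y)
    have h2 : 2 ^ γ * ‖z‖ ^ (-γ) * (4 * (A * heatKernel N (y - z) s)) ^ p ≤
        L * heatKernel N (y - z) s := by
      rw [← mul_assoc 4, mul_rpow (by positivity) hG2, hL]
      calc _ ≤ 2 ^ γ * ‖z‖ ^ (-γ) * ((4 * A) ^ p *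
            ((4 * π * s) ^ (-(N * (p - 1) / 2)) * heatKernel N (y - z) s)) := by
            gcongr
            exact heatKernel_rpow_le _ hs0 hp
        _ = _ := by
            rw [mul_rpow (by positivity) hs0.le]
            ring
    calc _ = heatKernel N (x - y) (t - s) *
          (‖y‖ ^ (-γ) * (2 * (A * heatKernel N (y - z) s) + 2 * D) ^ p) := by ring
      _ ≤ heatKernel N (x - y) (t - s) *
          ((4 * D) ^ p * ‖y‖ ^ (-γ) + L * heatKernel N (y - z) s) := by
          gcongr
          exact h1.trans (by gcongr)
      _ = _ := by ring
  refine (lintegral_mono hpt).trans ?_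
  rw [lintegral_add_left (by fun_prop), lintegral_const_mul _ (by fun_prop),
    lintegral_const_mul _ (by fun_prop), lintegral_heatKernel_mul_heatKernel x z hts hs0,
    sub_add_cancel]
  refine add_le_add ?_ (le_of_eq ?_)
  · rw [ENNReal.ofReal_mul (by positivity), mul_assoc, ← ENNReal.ofReal_mul hK]
    gcongr
    exact hpot x _ hts
  · have := heatKernel_nonneg (x - z) (hs0.trans hs.2).le
    rw [← ENNReal.ofReal_mul (by positivity), ← ENNReal.ofReal_mul (by positivity), hL]
    congr 1
    ring

theorem lintegral_heatKernel_initial_le {φ : EuclideanSpace ℝ (Fin N) → ℝ} (hφ : Measurable φ)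
    (hφD : ∀ᵐ x, φ x ≤ D) (hA : 0 ≤ A) (hD : 0 ≤ D) {t : ℝ} (ht : 0 < t)
    (x : EuclideanSpace ℝ (Fin N)) :
    ∫⁻ y, ENNReal.ofReal (heatKernel N (x - y) t) ∂(ENNReal.ofReal A • Measure.dirac z +
        volume.withDensity (fun y => ENNReal.ofReal (φ y))) ≤
      ENNReal.ofReal (A * heatKernel N (x - z) t + D) := by
  have hG := heatKernel_nonneg (x - z) ht.le
  rw [lintegral_add_measure, lintegral_smul_measure, lintegral_dirac' _ (by fun_prop), smul_eq_mul,
    lintegral_withDensity_eq_lintegral_mul _ (by fun_prop) (by fun_prop),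
    ENNReal.ofReal_add (by positivity) hD, ENNReal.ofReal_mul hA]
  gcongr
  calc _ ≤ ∫⁻ y, ENNReal.ofReal D * ENNReal.ofReal (heatKernel N (x - y) t) := by
        refine lintegral_mono_ae (hφD.mono fun y hy => ?_)
        exact mul_le_mul_left (ENNReal.ofReal_le_ofReal hy) _
    _ = _ := by rw [lintegral_const_mul _ (by fun_prop), lintegral_heatKernel x ht, mul_one]

theorem picardMap_supersolution_le {φ : EuclideanSpace ℝ (Fin N) → ℝ} (hφ : Measurable φ)
    (hφD : ∀ᵐ x, φ x ≤ D) (hγ : 0 < γ) (hγ2 : γ < 2) (hp : 1 < p) (hpF : N * (p - 1) / 2 < 1)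
    (hz : z ≠ 0) (hA : 0 ≤ A) (hD : 0 ≤ D) (hK : 0 ≤ K)
    (hpot : ∀ (x : EuclideanSpace ℝ (Fin N)) (t : ℝ), 0 < t →
      ∫⁻ y, ENNReal.ofReal (heatKernel N (x - y) t * ‖y‖ ^ (-γ)) ≤
        ENNReal.ofReal (K * t ^ (-(γ / 2))))
    (hfar : ∀ s ∈ Ioo 0 T, ∀ y : EuclideanSpace ℝ (Fin N), ‖y‖ < ‖z‖ / 2 →
      A * heatKernel N (y - z) s ≤ D)
    (hDT : (4 * D) ^ p * K * (T ^ (1 - γ / 2) / (1 - γ / 2)) ≤ D)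
    (hAT : 2 ^ γ * ‖z‖ ^ (-γ) * (4 * A) ^ p * (4 * π) ^ (-(N * (p - 1) / 2)) *
      (T ^ (1 - N * (p - 1) / 2) / (1 - N * (p - 1) / 2)) ≤ A)
    {t : ℝ} (ht : t ∈ Ioo 0 T) (x : EuclideanSpace ℝ (Fin N)) :
    picardMap γ p (ENNReal.ofReal A • Measure.dirac z +
        volume.withDensity (fun y => ENNReal.ofReal (φ y)))
      (fun x t => ENNReal.ofReal (2 * (A * heatKernel N (x - z) t) + 2 * D)) x t ≤
      ENNReal.ofReal (2 * (A * heatKernel N (x - z) t) + 2 * D) := by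
  have ht0 : 0 < t := ht.1
  have hG := heatKernel_nonneg (x - z) ht0.le
  have hγ' : 0 < 1 - γ / 2 := by linarith
  have hθ : 0 < 1 - N * (p - 1) / 2 := by linarith
  have hsum : 2 * (A * heatKernel N (x - z) t) + 2 * D =
      (A * heatKernel N (x - z) t + D) + (D + A * heatKernel N (x - z) t) := by ring
  rw [hsum, ENNReal.ofReal_add (by positivity) (by positivity)]
  refine add_le_add (lintegral_heatKernel_initial_le hφ hφD hA hD ht0 x) ?_
  refine (setLIntegral_mono' measurableSet_Ioo fun s hs =>
    lintegral_heatKernel_mul_source_le hγ hp hz hA hD hK hs x hpot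
      (hfar s ⟨hs.1, hs.2.trans ht.2⟩)).trans ?_
  rw [lintegral_add_left (by fun_prop), lintegral_const_mul _ (by fun_prop),
    lintegral_const_mul _ (by fun_prop), lintegral_Ioo_sub_rpow (by linarith) ht0,
    lintegral_Ioo_rpow hpF ht0, ← ENNReal.ofReal_mul (by positivity),
    ← ENNReal.ofReal_mul (by positivity), ENNReal.ofReal_add hD (by positivity)]
  refine add_le_add (ENNReal.ofReal_le_ofReal ?_) (ENNReal.ofReal_le_ofReal ?_)
  · refine le_trans ?_ hDT
    gcongr
    exact ht.2.le
  · calc _ ≤ 2 ^ γ * ‖z‖ ^ (-γ) * (4 * A) ^ p * (4 * π) ^ (-(N * (p - 1) / 2)) *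
          heatKernel N (x - z) t * (T ^ (1 - N * (p - 1) / 2) / (1 - N * (p - 1) / 2)) := by
          gcongr
          exact ht.2.le
      _ = 2 ^ γ * ‖z‖ ^ (-γ) * (4 * A) ^ p * (4 * π) ^ (-(N * (p - 1) / 2)) *
          (T ^ (1 - N * (p - 1) / 2) / (1 - N * (p - 1) / 2)) * heatKernel N (x - z) t := by ring
      _ ≤ _ := by gcongr

theorem exists_isSolMeas_dirac_add_withDensity {φ : EuclideanSpace ℝ (Fin N) → ℝ}
    (hφ : Measurable φ)
    (hφD : ∀ᵐ x, φ x ≤ D) (hγ : 0 < γ) (hγ2 : γ < 2) (hp : 1 < p) (hpF : N * (p - 1) / 2 < 1)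
    (hz : z ≠ 0) (hA : 0 ≤ A) (hD : 0 ≤ D) (hK : 0 ≤ K)
    (hpot : ∀ (x : EuclideanSpace ℝ (Fin N)) (t : ℝ), 0 < t →
      ∫⁻ y, ENNReal.ofReal (heatKernel N (x - y) t * ‖y‖ ^ (-γ)) ≤
        ENNReal.ofReal (K * t ^ (-(γ / 2))))
    (hfar : ∀ s ∈ Ioo 0 T, ∀ y : EuclideanSpace ℝ (Fin N), ‖y‖ < ‖z‖ / 2 →
      A * heatKernel N (y - z) s ≤ D)
    (hDT : (4 * D) ^ p * K * (T ^ (1 - γ / 2) / (1 - γ / 2)) ≤ D)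
    (hAT : 2 ^ γ * ‖z‖ ^ (-γ) * (4 * A) ^ p * (4 * π) ^ (-(N * (p - 1) / 2)) *
      (T ^ (1 - N * (p - 1) / 2) / (1 - N * (p - 1) / 2)) ≤ A) :
    ∃ u, IsSolMeas N γ p T (ENNReal.ofReal A • Measure.dirac z +
      volume.withDensity (fun y => ENNReal.ofReal (φ y))) u :=
  exists_isSolMeas_of_supersolution (by linarith) (fun _ _ _ => ENNReal.ofReal_lt_top)
    fun _ ht x => picardMap_supersolution_le hφ hφD hγ hγ2 hp hpF hz hA hD hK hpot hfar hDT hAT ht x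

end Supersolution

theorem rpow_neg_one_div_mul_rpow_le {B c q : ℝ} (hB : 0 < B) (hq : 0 < q) (hc : 0 ≤ c)
    (hcB : c ≤ B ^ (-(1 / q))) : B * c ^ q ≤ 1 := by
  calc B * c ^ q ≤ B * (B ^ (-(1 / q))) ^ q := by gcongr
    _ = 1 := by
      rw [← rpow_mul hB.le, neg_mul, one_div_mul_cancel hq.ne', rpow_neg_one,
        mul_inv_cancel₀ hB.ne']

theorem rpow_eq_self_mul_rpow_sub_one {a p : ℝ} (ha : 0 ≤ a) (hp : p ≠ 0) :
    a ^ p = a * a ^ (p - 1) := by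
  rw [← rpow_one_add' ha (by simpa using hp), add_sub_cancel]

theorem statement18 (N : ℕ) (hN : 1 ≤ N) (γ p : ℝ)
    (hγ0 : 0 < γ) (hγ : γ < min 2 (N : ℝ))
    (hp1 : 1 < p) (hp2 : p < 1 + 2 / (N : ℝ)) :
    ∃ cstar Cstar : ℝ, 0 < cstar ∧ 0 < Cstar ∧
      ∀ (T : ℝ), 0 < T →
      ∀ (z : EuclideanSpace ℝ (Fin N)), z ≠ 0 → T ≤ ‖z‖ ^ 2 →
      ∀ (φ : EuclideanSpace ℝ (Fin N) → ℝ) (c C₀ : ℝ),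
        Measurable φ → (∀ x, 0 ≤ φ x) →
        0 < c →
        c ≤ cstar * T ^ (-(N : ℝ) * ((1 + 2 / (N : ℝ)) - p) / (2 * (p - 1))) →
        0 ≤ C₀ → C₀ ≤ Cstar * T ^ (-(2 - γ) / (2 * (p - 1))) →
        (∀ᵐ x : EuclideanSpace ℝ (Fin N), φ x ≤ C₀) →
        ∃ u, IsSolMeas N γ p T
          (ENNReal.ofReal (c * ‖z‖ ^ (γ / (p - 1))) • Measure.dirac z +
            volume.withDensity (fun y => ENNReal.ofReal (φ y))) u := by
  have hN0 : (0 : ℝ) < N := by exact_mod_cast hN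
  have hγ2 : γ < 2 := hγ.trans_le (min_le_left _ _)
  have hγN : γ < N := hγ.trans_le (min_le_right _ _)
  have hq : 0 < p - 1 := by linarith
  have hpF : N * (p - 1) / 2 < 1 := by
    have : (p - 1) * N < 2 := (lt_div_iff₀ hN0).1 (by linarith)
    linarith
  have hθ : 0 < 1 - N * (p - 1) / 2 := by linarith
  have hγ' : 0 < 1 - γ / 2 := by linarith
  obtain ⟨K, hK, hpot⟩ := exists_lintegral_heatKernel_mul_norm_rpow_le hN hγ0 hγN
  set k : ℝ := γ / (p - 1) with hk
  have hk0 : 0 < k := by positivity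
  set F : ℝ := ((N + k) / 2) ^ ((N + k) / 2) * 16 ^ ((N + k) / 2) * (4 * π) ^ (-(N : ℝ) / 2) with hF
  have hF0 : 0 < F := by positivity
  set B₁ : ℝ := 4 ^ p * K / (1 - γ / 2) with hB₁
  have hB₁0 : 0 < B₁ := by positivity
  set B₂ : ℝ := 2 ^ γ * 4 ^ p * (4 * π) ^ (-(N * (p - 1) / 2)) / (1 - N * (p - 1) / 2) with hB₂
  have hB₂0 : 0 < B₂ := by positivity
  set ε : ℝ := B₁ ^ (-(1 / (p - 1))) with hε
  have hε0 : 0 < ε := by positivity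
  set δ : ℝ := min (B₂ ^ (-(1 / (p - 1)))) (ε / F) with hδ
  have hδ0 : 0 < δ := by positivity
  refine ⟨δ, ε, hδ0, hε0, ?_⟩
  intro T hT z hz hTz φ c C₀ hφ _ hc hcT _ hC₀ hφC
  have hz0 : 0 < ‖z‖ := norm_pos_iff.2 hz
  set e : ℝ := -(N : ℝ) * ((1 + 2 / (N : ℝ)) - p) / (2 * (p - 1)) with he
  set M : ℝ := T ^ (-(2 - γ) / (2 * (p - 1))) with hM
  have hM0 : 0 < M := by positivity
  have hA0 : 0 ≤ c * ‖z‖ ^ k := by positivity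
  refine exists_isSolMeas_dirac_add_withDensity (D := ε * M) hφ
    (hφC.mono fun x hx => hx.trans hC₀) hγ0 hγ2 hp1 hpF hz hA0 (by positivity) hK.le hpot ?_ ?_ ?_
  · intro s hs y hy
    have hs0 : 0 < s := hs.1
    have hzN : ‖z‖ ^ (-(N : ℝ)) ≤ T ^ (-(N : ℝ) / 2) := by
      calc ‖z‖ ^ (-(N : ℝ)) = (‖z‖ ^ 2) ^ (-(N : ℝ) / 2) := by
            rw [← rpow_natCast ‖z‖ 2, ← rpow_mul hz0.le]
            congr 1
            push_cast
            ring
        _ ≤ _ := rpow_le_rpow_of_nonpos hT hTz (by linarith)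
    calc c * ‖z‖ ^ k * heatKernel N (y - z) s
        ≤ c * ‖z‖ ^ k * (F * s ^ (k / 2) * ‖z‖ ^ (-(N + k))) := by
          gcongr
          exact heatKernel_sub_le_of_norm_lt hs0 (by positivity) hy
      _ = c * F * s ^ (k / 2) * ‖z‖ ^ (-(N : ℝ)) := by
          rw [show ‖z‖ ^ (-(N : ℝ)) = ‖z‖ ^ k * ‖z‖ ^ (-(N + k)) by
            rw [← rpow_add hz0]; congr 1; ring]
          ring
      _ ≤ (ε / F * T ^ e) * F * T ^ (k / 2) * T ^ (-(N : ℝ) / 2) := by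
          gcongr
          · exact hcT.trans (by gcongr; exact min_le_right _ _)
          · exact hs.2.le
      _ = ε * (T ^ e * T ^ (k / 2) * T ^ (-(N : ℝ) / 2)) := by field_simp
      _ = ε * M := by
          rw [← rpow_add hT, ← rpow_add hT, hM, he, hk]
          congr 2
          field_simp
          ring
  · have hMT : M ^ (p - 1) * T ^ (1 - γ / 2) = 1 := by
      rw [hM, ← rpow_mul hT.le, ← rpow_add hT]
      refine Eq.trans ?_ (rpow_zero T)
      congr 1
      field_simp
      ring
    calc (4 * (ε * M)) ^ p * K * (T ^ (1 - γ / 2) / (1 - γ / 2))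
        = B₁ * ε ^ (p - 1) * (M ^ (p - 1) * T ^ (1 - γ / 2)) * (ε * M) := by
          rw [mul_rpow (by norm_num) (by positivity),
            rpow_eq_self_mul_rpow_sub_one (a := ε * M) (by positivity) (by linarith),
            mul_rpow hε0.le hM0.le, hB₁]
          ring
      _ ≤ 1 * 1 * (ε * M) := by
          gcongr
          · exact rpow_neg_one_div_mul_rpow_le hB₁0 hq hε0.le le_rfl
          · exact hMT.le
      _ = ε * M := by ring
  · have hTe : (T ^ e) ^ (p - 1) * T ^ (1 - N * (p - 1) / 2) = 1 := by
      rw [← rpow_mul hT.le, ← rpow_add hT, he]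
      refine Eq.trans ?_ (rpow_zero T)
      congr 1
      field_simp
      ring
    have hzk : ‖z‖ ^ (-γ) * (‖z‖ ^ k) ^ (p - 1) = 1 := by
      rw [← rpow_mul hz0.le, ← rpow_add hz0, hk]
      refine Eq.trans ?_ (rpow_zero ‖z‖)
      congr 1
      field_simp
      ring
    calc 2 ^ γ * ‖z‖ ^ (-γ) * (4 * (c * ‖z‖ ^ k)) ^ p * (4 * π) ^ (-(N * (p - 1) / 2)) *
          (T ^ (1 - N * (p - 1) / 2) / (1 - N * (p - 1) / 2))
        = B₂ * c ^ (p - 1) * T ^ (1 - N * (p - 1) / 2) *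
            (‖z‖ ^ (-γ) * (‖z‖ ^ k) ^ (p - 1)) * (c * ‖z‖ ^ k) := by
          rw [mul_rpow (by norm_num) hA0,
            rpow_eq_self_mul_rpow_sub_one (a := c * ‖z‖ ^ k) hA0 (by linarith),
            mul_rpow hc.le (by positivity), hB₂]
          ring
      _ ≤ B₂ * (δ * T ^ e) ^ (p - 1) * T ^ (1 - N * (p - 1) / 2) * 1 * (c * ‖z‖ ^ k) := by
          gcongr
          exact hzk.le
      _ = B₂ * δ ^ (p - 1) * ((T ^ e) ^ (p - 1) * T ^ (1 - N * (p - 1) / 2)) *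
            (c * ‖z‖ ^ k) := by
          rw [mul_rpow hδ0.le (by positivity)]
          ring
      _ ≤ 1 * 1 * (c * ‖z‖ ^ k) := by
          gcongr
          · exact rpow_neg_one_div_mul_rpow_le hB₂0 hq hδ0.le (min_le_left _ _)
          · exact hTe.le
      _ = c * ‖z‖ ^ k := by ring
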